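/- arXiv:1406.4822 — 2 statements merged into one kernel-verified Lean document; each statement's English description precedes it below -/
import Mathlib

section
/- Let s > 0, let T > 0, and let Q ⊆ P be a subset whose points are pairwise at distance greater than s. Suppose all points of Q lie in the closed ball B(q, R) for some q ∈ P and some radius R with s/2 ≤ R ≤ T. Then the cardinality of Q is at most λ_T^{⌈log₂(2R/s)⌉}, where λ_T is the T-restricted doubling constant of P. -/
open Metric

/-- `P ∩ B(p, r)` can be covered by at most `m` closed balls of radius `r/2`,
each centered at a point of `P`. -/
def CoverCond {d : ℕ} (P : Finset (EuclideanSpace ℝ (Fin d))) (m : ℕ)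
    (p : EuclideanSpace ℝ (Fin d)) (r : ℝ) : Prop :=
  ∃ C : Finset (EuclideanSpace ℝ (Fin d)), C ⊆ P ∧ C.card ≤ m ∧
    ∀ q ∈ P, dist q p ≤ r → ∃ c ∈ C, dist q c ≤ r / 2

/-- The `t`-restricted doubling constant `λ_t` of `P`: the smallest positive integer `m`
such that for all `p ∈ P` and all radii `0 < r ≤ t`, `P ∩ B(p,r)` is covered by `m`
closed balls of radius `r/2` centered at points of `P`. -/
noncomputable def restDoublingConst {d : ℕ} (P : Finset (EuclideanSpace ℝ (Fin d)))
    (t : ℝ) : ℕ :=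
  sInf {m : ℕ | 0 < m ∧ ∀ p ∈ P, ∀ r : ℝ, 0 < r → r ≤ t → CoverCond P m p r}

theorem CoverCond.mono_card {d : ℕ} {P : Finset (EuclideanSpace ℝ (Fin d))} {m n : ℕ}
    {p : EuclideanSpace ℝ (Fin d)} {r : ℝ} (h : CoverCond P m p r) (hmn : m ≤ n) :
    CoverCond P n p r := by
  obtain ⟨C, hC, hcard, hcov⟩ := h
  exact ⟨C, hC, hcard.trans hmn, hcov⟩

/-- Every finite set is covered by the balls around all of its points. -/
theorem coverCond_card {d : ℕ} (P : Finset (EuclideanSpace ℝ (Fin d)))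
    (p : EuclideanSpace ℝ (Fin d)) {r : ℝ} (hr : 0 < r) : CoverCond P P.card p r :=
  ⟨P, Finset.Subset.refl P, le_rfl, fun x hx _ => ⟨x, hx, by rw [dist_self]; positivity⟩⟩

/-- The restricted doubling constant has the covering property that defines it. -/
theorem coverCond_restDoublingConst {d : ℕ} {P : Finset (EuclideanSpace ℝ (Fin d))} {t r : ℝ}
    {p : EuclideanSpace ℝ (Fin d)} (hp : p ∈ P) (hr : 0 < r) (hrt : r ≤ t) :
    CoverCond P (restDoublingConst P t) p r := by
  have hne : {m : ℕ | 0 < m ∧ ∀ p ∈ P, ∀ r : ℝ, 0 < r → r ≤ t → CoverCond P m p r}.Nonempty :=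
    ⟨P.card + 1, P.card.succ_pos, fun p _ r hr _ =>
      (coverCond_card P p hr).mono_card P.card.le_succ⟩
  exact (Nat.sInf_mem hne).2 p hp r hr hrt

/-- Halving the radius `n` times bounds the size of a separated set by the `n`-th power of
any number that bounds the covers at all scales up to `T`. -/
theorem card_le_pow_of_coverCond {d : ℕ} {P : Finset (EuclideanSpace ℝ (Fin d))} {m : ℕ}
    {s T : ℝ} (hm : ∀ p ∈ P, ∀ r : ℝ, 0 < r → r ≤ T → CoverCond P m p r) (n : ℕ) :
    ∀ (Q : Finset (EuclideanSpace ℝ (Fin d))) (p : EuclideanSpace ℝ (Fin d)) (r : ℝ),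
      Q ⊆ P → (∀ x ∈ Q, ∀ y ∈ Q, x ≠ y → s < dist x y) → p ∈ P → 0 < r → r ≤ T →
      r ≤ s / 2 * 2 ^ n → (∀ x ∈ Q, dist x p ≤ r) → Q.card ≤ m ^ n := by
  classical
  induction n with
  | zero =>
    intro Q p r _ hsep _ _ _ hrs hball
    rw [pow_zero, Finset.card_le_one]
    intro x hx y hy
    by_contra hxy
    have := hsep x hx y hy hxy
    have := dist_triangle_right x y p
    have := hball x hx
    have := hball y hy
    linarith
  | succ n ih =>
    intro Q p r hQP hsep hp hr hrT hrs hball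
    obtain ⟨C, hCP, hCcard, hcov⟩ := hm p hp r hr hrT
    have hsub : Q ⊆ C.biUnion fun c => Q.filter fun x => dist x c ≤ r / 2 := by
      intro x hx
      obtain ⟨c, hc, hxc⟩ := hcov x (hQP hx) (hball x hx)
      exact Finset.mem_biUnion.2 ⟨c, hc, Finset.mem_filter.2 ⟨hx, hxc⟩⟩
    calc Q.card ≤ C.card * m ^ n := (Finset.card_le_card hsub).trans <|
          Finset.card_biUnion_le_card_mul _ _ _ fun c hc =>
            ih _ c (r / 2) ((Finset.filter_subset _ _).trans hQP)
              (fun x hx y hy => hsep x (Finset.mem_filter.1 hx).1 y (Finset.mem_filter.1 hy).1)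
              (hCP hc) (by positivity) (by linarith) (by rw [pow_succ] at hrs; linarith)
              (fun x hx => (Finset.mem_filter.1 hx).2)
      _ ≤ m * m ^ n := Nat.mul_le_mul_right _ hCcard
      _ = m ^ (n + 1) := (pow_succ' m n).symm

/-- Packing lemma: a subset `Q ⊆ P` of pairwise distance `> s` contained in a closed ball
`B(q, R)` with `q ∈ P` and `s/2 ≤ R ≤ T` has at most `λ_T ^ ⌈log₂ (2R/s)⌉` points. -/
theorem packing_bound {d : ℕ} (P Q : Finset (EuclideanSpace ℝ (Fin d)))
    (hP : P.Nonempty) (s T R : ℝ) (hs : 0 < s) (hT : 0 < T)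
    (hQP : Q ⊆ P)
    (hsep : ∀ q₁ ∈ Q, ∀ q₂ ∈ Q, q₁ ≠ q₂ → s < dist q₁ q₂)
    (q : EuclideanSpace ℝ (Fin d)) (hq : q ∈ P)
    (hRlow : s / 2 ≤ R) (hRhigh : R ≤ T)
    (hball : ∀ p ∈ Q, dist p q ≤ R) :
    Q.card ≤ restDoublingConst P T ^ (⌈Real.logb 2 (2 * R / s)⌉.toNat) := by
  have hR : 0 < R := by linarith
  refine card_le_pow_of_coverCond (s := s)
    (fun p hp r hr hrT => coverCond_restDoublingConst hp hr hrT)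
    _ Q q R hQP hsep hq hR hRhigh ?_ hball
  have hlog : Real.logb 2 (2 * R / s) ≤ (⌈Real.logb 2 (2 * R / s)⌉.toNat : ℝ) :=
    (Int.le_ceil _).trans (by exact_mod_cast Int.self_le_toNat _)
  rw [Real.logb_le_iff_le_rpow one_lt_two (by positivity), Real.rpow_natCast,
    div_le_iff₀ hs] at hlog
  linarith
end

section
/- Let t > 0 and let Q ⊆ P be a (t, t)-net of P. Then for every net point p ∈ Q, the number of net points q ∈ Q with ‖p − q‖ ≤ 7t is at most λ_{7t}^{⌈log₂ 14⌉}, where λ_{7t} is the (7t)-restricted doubling constant of P. -/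
open Metric

/-- `Q` is a `(t, t)`-net of `P`. -/
def IsNet {d : ℕ} (P Q : Finset (EuclideanSpace ℝ (Fin d))) (t : ℝ) : Prop :=
  Q ⊆ P ∧ (∀ p ∈ P, ∃ q ∈ Q, dist p q ≤ t) ∧
    (∀ q₁ ∈ Q, ∀ q₂ ∈ Q, q₁ ≠ q₂ → t < dist q₁ q₂)

theorem restDoublingConst_spec {d : ℕ} (P : Finset (EuclideanSpace ℝ (Fin d)))
    (hP : P.Nonempty) (t : ℝ) :
    0 < restDoublingConst P t ∧
      ∀ p ∈ P, ∀ r : ℝ, 0 < r → r ≤ t → CoverCond P (restDoublingConst P t) p r := by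
  have hne : {m : ℕ | 0 < m ∧
      ∀ p ∈ P, ∀ r : ℝ, 0 < r → r ≤ t → CoverCond P m p r}.Nonempty := by
    refine ⟨P.card, hP.card_pos, fun p _ r hr _ => ⟨P, subset_rfl, le_rfl, fun q hq _ => ?_⟩⟩
    exact ⟨q, hq, by rw [dist_self]; positivity⟩
  exact Nat.sInf_mem hne

/-- Iterating the doubling property `k` times covers `P ∩ B(p, r)` by `λ_t ^ k` balls of
radius `r / 2 ^ k`. -/
theorem exists_cover_restDoublingConst_pow {d : ℕ} (P : Finset (EuclideanSpace ℝ (Fin d)))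
    (hP : P.Nonempty) {t r : ℝ} (hr : 0 < r) (hrt : r ≤ t)
    {p : EuclideanSpace ℝ (Fin d)} (hp : p ∈ P) (k : ℕ) :
    ∃ C : Finset (EuclideanSpace ℝ (Fin d)), C ⊆ P ∧ C.card ≤ restDoublingConst P t ^ k ∧
      ∀ q ∈ P, dist q p ≤ r → ∃ c ∈ C, dist q c ≤ r / 2 ^ k := by
  classical
  induction k with
  | zero => exact ⟨{p}, by simpa using hp, by simp, fun q _ h => ⟨p, by simp, by simpa using h⟩⟩
  | succ k ih =>
    obtain ⟨C, hCP, hC, hcov⟩ := ih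
    have hrk : r / 2 ^ k ≤ t :=
      (div_le_self hr.le (one_le_pow₀ one_le_two)).trans hrt
    choose! D hDP hD hDcov using fun c (hc : c ∈ C) =>
      (restDoublingConst_spec P hP t).2 c (hCP hc) (r / 2 ^ k) (by positivity) hrk
    refine ⟨C.biUnion D, Finset.biUnion_subset.2 hDP, ?_, fun q hq hqp => ?_⟩
    · rw [pow_succ]
      exact (Finset.card_biUnion_le_card_mul C D _ hD).trans (Nat.mul_le_mul_right _ hC)
    · obtain ⟨c, hc, hqc⟩ := hcov q hq hqp
      obtain ⟨e, he, hqe⟩ := hDcov c hc q hq hqc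
      exact ⟨e, Finset.mem_biUnion.2 ⟨c, hc, he⟩, by rwa [pow_succ, ← div_div]⟩

theorem ceil_logb_two_fourteen : ⌈Real.logb 2 14⌉ = 4 := by
  rw [Int.ceil_eq_iff]
  constructor
  · rw [Real.lt_logb_iff_rpow_lt (by norm_num) (by norm_num)]
    norm_num
  · rw [Real.logb_le_iff_le_rpow (by norm_num) (by norm_num)]
    norm_num

/-- Each net point of a `(t, t)`-net has at most `λ_{7t}^{⌈log₂ 14⌉}` net points
within distance `7t`. -/
theorem net_neighbours_bound {d : ℕ} (P Q : Finset (EuclideanSpace ℝ (Fin d)))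
    (hP : P.Nonempty) (t : ℝ) (ht : 0 < t) (hnet : IsNet P Q t)
    (p : EuclideanSpace ℝ (Fin d)) (hp : p ∈ Q) :
    (Q.filter (fun q => dist p q ≤ 7 * t)).card ≤
      restDoublingConst P (7 * t) ^ (⌈Real.logb 2 14⌉.toNat) := by
  obtain ⟨hQP, -, hsep⟩ := hnet
  obtain ⟨C, -, hC, hcov⟩ := exists_cover_restDoublingConst_pow P hP
    (by positivity : 0 < 7 * t) le_rfl (hQP hp) 4
  rw [ceil_logb_two_fourteen]
  refine le_trans ?_ hC
  choose! f hfC hf using hcov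
  refine Finset.card_le_card_of_injOn f (fun q hq => ?_) (fun q hq q' hq' h => ?_)
  · obtain ⟨hq, hqp⟩ := Finset.mem_filter.1 hq
    exact hfC q (hQP hq) (by rwa [dist_comm])
  · obtain ⟨hq, hqp⟩ := Finset.mem_filter.1 hq
    obtain ⟨hq', hqp'⟩ := Finset.mem_filter.1 hq'
    by_contra hne
    have h₁ := hf q (hQP hq) (by rwa [dist_comm])
    have h₂ := hf q' (hQP hq') (by rwa [dist_comm])
    rw [← h] at h₂
    linarith [hsep q hq q' hq' hne, dist_triangle_right q q' (f q)]
end
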